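/- Let d > 0, R > 0, and let Ω = B_R ⊂ ℝ³ be the open ball of radius R centered at the origin. Let a : cl(B_R) → ℝ³ be a continuously differentiable vector field with div a = 0 on B_R. Assume f satisfies (F), g satisfies (G-ext), f'(0) + ln(g'(0)) > 0, and R < R* := π·√(d/(f'(0) + ln(g'(0)))). Then every solution of the impulsive reaction–diffusion system on B_R satisfies lim_{m→∞} N_m(x) = 0 for every x ∈ B_R. -/

import Mathlib

open Real Filter MeasureTheory
open scoped Topology ENNReal

noncomputable section

/-- First-order partial derivative of `u` in the `i`-th coordinate direction. -/
def pd {n : ℕ} (u : EuclideanSpace ℝ (Fin n) → ℝ) (i : Fin n)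
    (x : EuclideanSpace ℝ (Fin n)) : ℝ :=
  fderiv ℝ u x (EuclideanSpace.single i 1)

/-- Second-order partial derivative `∂ᵢ∂ⱼ u`. -/
def pd2 {n : ℕ} (u : EuclideanSpace ℝ (Fin n) → ℝ) (i j : Fin n)
    (x : EuclideanSpace ℝ (Fin n)) : ℝ :=
  pd (fun y => pd u j y) i x

/-- Laplacian of `u`. -/
def lap {n : ℕ} (u : EuclideanSpace ℝ (Fin n) → ℝ) (x : EuclideanSpace ℝ (Fin n)) : ℝ :=
  ∑ i, pd2 u i i x

/-- Assumption (F): `f` is locally Lipschitz, `f 0 = 0`, `f` is differentiable at `0`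
with derivative `f'0 ≠ 0`, and there is a differentiable `h` with `h 0 = h' 0 = 0` such that
`f'0 * N - h N ≤ f N ≤ f'0 * N` for all `N ≥ 0`. -/
def SatF (f : ℝ → ℝ) (f'0 : ℝ) : Prop :=
  LocallyLipschitz f ∧ f 0 = 0 ∧ HasDerivAt f f'0 0 ∧ f'0 ≠ 0 ∧
    ∃ h : ℝ → ℝ, Differentiable ℝ h ∧ h 0 = 0 ∧ deriv h 0 = 0 ∧
      ∀ N : ℝ, 0 ≤ N → f'0 * N - h N ≤ f N ∧ f N ≤ f'0 * N

/-- Assumption (G-ext): `g : [0,∞) → [0,∞)` is continuous, `g 0 = 0`, `g N > 0` for `N > 0`,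
`g` is differentiable at `0` (within `[0,∞)`) with derivative `g'0 > 0`, and
`g N ≤ g'0 * N` for all `N > 0`. -/
def SatGext (g : ℝ → ℝ) (g'0 : ℝ) : Prop :=
  ContinuousOn g (Set.Ici 0) ∧ g 0 = 0 ∧ (∀ N : ℝ, 0 < N → 0 < g N) ∧
    HasDerivWithinAt g g'0 (Set.Ici 0) 0 ∧ 0 < g'0 ∧ ∀ N : ℝ, 0 < N → g N ≤ g'0 * N

/-- A solution of the impulsive reaction-diffusion system
`∂ₜ u⁽ᵐ⁾ = d Δu⁽ᵐ⁾ - a ⬝ ∇u⁽ᵐ⁾ + f (u⁽ᵐ⁾)` on `Ω × (0,1]` with hostile (Dirichlet) boundary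
conditions, initial data `u⁽ᵐ⁾(·,0) = g (N_m ·)` and update rule `N_{m+1} = u⁽ᵐ⁾(·,1)`. -/
structure ImpSol (n : ℕ) (Ω : Set (EuclideanSpace ℝ (Fin n))) (d : ℝ)
    (a : EuclideanSpace ℝ (Fin n) → EuclideanSpace ℝ (Fin n)) (f g : ℝ → ℝ) where
  N : ℕ → EuclideanSpace ℝ (Fin n) → ℝ
  u : ℕ → EuclideanSpace ℝ (Fin n) → ℝ → ℝ
  N_cont : ∀ m, ContinuousOn (N m) (closure Ω)
  N_nonneg : ∀ m, ∀ x ∈ closure Ω, 0 ≤ N m x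
  N0_bdry : ∀ x ∈ frontier Ω, N 0 x = 0
  u_nonneg : ∀ m, ∀ x ∈ closure Ω, ∀ t ∈ Set.Icc (0:ℝ) 1, 0 ≤ u m x t
  u_cont : ∀ m, ContinuousOn (fun p : EuclideanSpace ℝ (Fin n) × ℝ => u m p.1 p.2)
    (closure Ω ×ˢ Set.Icc (0:ℝ) 1)
  u_space_C2 : ∀ m, ∀ t ∈ Set.Ioc (0:ℝ) 1, ∀ x ∈ Ω, ContDiffAt ℝ 2 (fun y => u m y t) x
  u_time_C1 : ∀ m, ∀ x ∈ Ω, ∀ t ∈ Set.Ioc (0:ℝ) 1, ContDiffAt ℝ 1 (fun s => u m x s) t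
  pde : ∀ m, ∀ x ∈ Ω, ∀ t ∈ Set.Ioc (0:ℝ) 1,
    deriv (fun s => u m x s) t =
      d * lap (fun y => u m y t) x - (∑ i, a x i * pd (fun y => u m y t) i x) + f (u m x t)
  bdry : ∀ m, ∀ x ∈ frontier Ω, ∀ t ∈ Set.Ioc (0:ℝ) 1, u m x t = 0
  init : ∀ m, ∀ x ∈ Ω, u m x 0 = g (N m x)
  recur : ∀ m, ∀ x ∈ closure Ω, N (m + 1) x = u m x 1

open scoped ContDiff
abbrev E3 := EuclideanSpace ℝ (Fin 3)

def Tc {F : Type} [NormedAddCommGroup F] [NormedSpace ℝ F] (ν : Measure E3) (c : E3 → ℝ)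
    (η : E3 → F) (x : E3) : F := ∫ y, c y • η (x - y) ∂ν

lemma Tc_int {F : Type} [NormedAddCommGroup F] [NormedSpace ℝ F] [FiniteDimensional ℝ F]
    (ν : Measure E3) (c : E3 → ℝ)
    (hc : Integrable c ν) (η : E3 → F) (hη : Continuous η) (hs : HasCompactSupport η) (x : E3) :
    Integrable (fun y => c y • η (x - y)) ν := by
  obtain ⟨C, hC⟩ := hη.bounded_above_of_compact_support hs
  have : SecondCountableTopology F := by
    have := FiniteDimensional.proper ℝ F
    infer_instance
  refine Integrable.mono' (hc.norm.mul_const C) ?_ ?_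
  · exact hc.aestronglyMeasurable.smul
      (Continuous.aestronglyMeasurable (by fun_prop))
  · filter_upwards with y
    rw [norm_smul]
    exact mul_le_mul_of_nonneg_left (hC _) (norm_nonneg _)

lemma Tc_hasFDerivAt {F : Type} [NormedAddCommGroup F] [NormedSpace ℝ F] [FiniteDimensional ℝ F]
    (ν : Measure E3) (c : E3 → ℝ)
    (hc : Integrable c ν) (η : E3 → F) (hη : ContDiff ℝ ∞ η) (hs : HasCompactSupport η) (x : E3) :
    HasFDerivAt (Tc ν c η) (Tc ν c (fderiv ℝ η) x) x := by
  have hη1 : ContDiff ℝ ∞ (fderiv ℝ η) := hη.fderiv_right (by simp)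
  obtain ⟨C, hC⟩ := hη1.continuous.bounded_above_of_compact_support (hs.fderiv ℝ)
  refine hasFDerivAt_integral_of_dominated_of_fderiv_le (s := Set.univ) (F := fun x y => c y • η (x - y))
    (F' := fun x y => c y • fderiv ℝ η (x - y)) (bound := fun y => ‖c y‖ * C) univ_mem ?_ ?_ ?_ ?_ ?_ ?_
  · filter_upwards with z
    exact (Tc_int ν c hc η hη.continuous hs z).aestronglyMeasurable
  · exact Tc_int ν c hc η hη.continuous hs x
  · exact (Tc_int ν c hc _ hη1.continuous (hs.fderiv ℝ) x).aestronglyMeasurable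
  · filter_upwards with y z _
    rw [norm_smul]
    exact mul_le_mul_of_nonneg_left (hC _) (norm_nonneg _)
  · exact hc.norm.mul_const C
  · filter_upwards with y z _
    have h1 : HasFDerivAt η (fderiv ℝ η (z - y)) (z - y) :=
      (hη.differentiable (by simp) _).hasFDerivAt
    have h2 : HasFDerivAt (fun z : E3 => z - y) (ContinuousLinearMap.id ℝ E3) z :=
      (hasFDerivAt_id z).sub_const y
    have := (h1.comp z h2).const_smul (c y)
    rw [ContinuousLinearMap.comp_id] at this
    exact this

lemma Tc_contDiff (n : ℕ) : ∀ {F : Type} [NormedAddCommGroup F] [NormedSpace ℝ F] [FiniteDimensional ℝ F]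
    (ν : Measure E3) (c : E3 → ℝ)
    (_ : Integrable c ν) (η : E3 → F) (_ : ContDiff ℝ ∞ η) (_ : HasCompactSupport η),
    ContDiff ℝ n (Tc ν c η) := by
  induction n with
  | zero =>
    intro F _ _ _ ν c hc η hη hs
    rw [Nat.cast_zero, contDiff_zero, continuous_iff_continuousAt]
    exact fun x => (Tc_hasFDerivAt ν c hc η hη hs x).continuousAt
  | succ n ih =>
    intro F _ _ _ ν c hc η hη hs
    have h : fderiv ℝ (Tc ν c η) = Tc ν c (fderiv ℝ η) :=
      funext fun x => (Tc_hasFDerivAt ν c hc η hη hs x).fderiv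
    have := contDiff_succ_iff_fderiv (𝕜 := ℝ) (f := Tc ν c η) (n := (n : WithTop ℕ∞))
    rw [Nat.cast_add, Nat.cast_one, this]
    refine ⟨fun x => (Tc_hasFDerivAt ν c hc η hη hs x).differentiableAt, by simp, ?_⟩
    rw [h]
    exact ih ν c hc _ (hη.fderiv_right (by simp)) (hs.fderiv ℝ)

lemma Tc_pd (ν : Measure E3) (c : E3 → ℝ)
    (hc : Integrable c ν) (η : E3 → ℝ) (hη : ContDiff ℝ ∞ η) (hs : HasCompactSupport η) (i : Fin 3) :
    pd (Tc ν c η) i = Tc ν c (pd η i) := by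
  funext x
  have h1 : ContDiff ℝ ∞ (fderiv ℝ η) := hη.fderiv_right (by simp)
  rw [pd, (Tc_hasFDerivAt ν c hc η hη hs x).fderiv, Tc,
    ContinuousLinearMap.integral_apply (Tc_int ν c hc _ h1.continuous (hs.fderiv ℝ) x)]
  rfl

lemma pd_contDiff (η : E3 → ℝ) (hη : ContDiff ℝ ∞ η) (i : Fin 3) : ContDiff ℝ ∞ (pd η i) := by
  have h1 : ContDiff ℝ ∞ (fderiv ℝ η) := hη.fderiv_right (by simp)
  exact h1.clm_apply contDiff_const

lemma pd_compact (η : E3 → ℝ) (hη : HasCompactSupport η) (i : Fin 3) : HasCompactSupport (pd η i) :=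
  hη.fderiv_apply ℝ _

lemma integral_pd (F : E3 → ℝ) (hF : ContDiff ℝ 1 F) (hs : HasCompactSupport F) (i : Fin 3) :
    Integrable (pd F i) ∧ ∫ x, pd F i x = 0 := by
  have h1 : Continuous (pd F i) := (hF.continuous_fderiv (by simp)).clm_apply continuous_const
  have h2 : Integrable (pd F i) := h1.integrable_of_hasCompactSupport (pd_compact F hs i)
  have h3 : Integrable F := hF.continuous.integrable_of_hasCompactSupport hs
  refine ⟨h2, ?_⟩
  have := integral_mul_fderiv_eq_neg_fderiv_mul_of_integrable (μ := (volume : Measure E3))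
    (f := fun _ => (1:ℝ)) (g := F) (v := EuclideanSpace.single i 1) (by simp) (by simpa [pd] using! h2) (by simpa using h3)
    (by simp) (fun x _ => hF.differentiable (by simp) x)
  simpa [pd] using! this
def Qf (k σ : ℝ) : ℝ := (k * √σ * (Real.cos (k * √σ) / Real.sin (k * √σ)) - 1) / σ

lemma trig1 (z : ℝ) (h0 : 0 ≤ z) (h1 : z ≤ π) : 0 ≤ Real.sin z - z * Real.cos z := by
  have hm : MonotoneOn (fun z : ℝ => Real.sin z - z * Real.cos z) (Set.Icc 0 π) := by
    apply monotoneOn_of_deriv_nonneg (convex_Icc 0 π) (by fun_prop) (by fun_prop)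
    intro x hx
    rw [interior_Icc] at hx
    have : HasDerivAt (fun z : ℝ => Real.sin z - z * Real.cos z)
      (Real.cos x - (1 * Real.cos x + x * (-Real.sin x))) x :=
      (Real.hasDerivAt_sin x).sub ((hasDerivAt_id x).mul (Real.hasDerivAt_cos x))
    rw [this.deriv]
    have := Real.sin_nonneg_of_nonneg_of_le_pi hx.1.le hx.2.le
    nlinarith [mul_nonneg hx.1.le this]
  have := hm ⟨le_rfl, pi_pos.le⟩ ⟨h0, h1⟩ h0
  simpa using this

lemma trig2 (z : ℝ) (h0 : 0 ≤ z) (h1 : z ≤ π) : 0 ≤ (3 - z^2) * Real.sin z - 3 * (z * Real.cos z) := by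
  have hm : MonotoneOn (fun z : ℝ => (3 - z^2) * Real.sin z - 3 * (z * Real.cos z)) (Set.Icc 0 π) := by
    apply monotoneOn_of_deriv_nonneg (convex_Icc 0 π) (by fun_prop) (by fun_prop)
    intro x hx
    rw [interior_Icc] at hx
    have : HasDerivAt (fun z : ℝ => (3 - z^2) * Real.sin z - 3 * (z * Real.cos z))
      ((-(2 * x)) * Real.sin x + (3 - x^2) * Real.cos x - 3 * (1 * Real.cos x + x * (-Real.sin x))) x := by
      refine HasDerivAt.sub (HasDerivAt.mul ?_ (Real.hasDerivAt_sin x)) (((hasDerivAt_id x).mul (Real.hasDerivAt_cos x)).const_mul 3)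
      simpa using (hasDerivAt_pow 2 x).const_sub 3
    rw [this.deriv]
    have := trig1 x hx.1.le hx.2.le
    nlinarith [mul_nonneg hx.1.le this]
  have := hm ⟨le_rfl, pi_pos.le⟩ ⟨h0, h1⟩ h0
  simpa using this

lemma Qf_le (k σ : ℝ) (hk : 0 < k) (hσ : 0 < σ) (h : k * √σ < π) : Qf k σ ≤ - k^2/3 := by
  have hs : 0 < √σ := Real.sqrt_pos.2 hσ
  have hz : 0 < k * √σ := by positivity
  have hsin := Real.sin_pos_of_pos_of_lt_pi hz h
  have h2 := trig2 (k * √σ) hz.le h.le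
  have hsq : (k * √σ)^2 = k^2 * σ := by rw [mul_pow, Real.sq_sqrt hσ.le]
  rw [Qf, div_le_iff₀ hσ, sub_le_iff_le_add, ← mul_div_assoc, div_le_iff₀ hsin]
  rw [hsq] at h2
  nlinarith

lemma Qf_deriv (k σ : ℝ) (hk : 0 < k) (hσ : 0 < σ) (h : k * √σ < π) :
    ∃ q', HasDerivAt (Qf k) q' σ ∧ 3 * Qf k σ + 2 * σ * q' + σ * (Qf k σ)^2 = -k^2 := by
  have hs : 0 < √σ := Real.sqrt_pos.2 hσ
  have hz : 0 < k * √σ := by positivity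
  have hsin := Real.sin_pos_of_pos_of_lt_pi hz h
  have d1 : HasDerivAt (fun s => k * √s) (k * (1 / (2 * √σ))) σ :=
    (Real.hasDerivAt_sqrt hσ.ne').const_mul k
  have d2 := (d1.mul ((d1.cos).div (d1.sin) hsin.ne')).sub_const 1
  have d3 := d2.div (hasDerivAt_id σ) hσ.ne'
  refine ⟨_, d3, ?_⟩
  simp only [Qf, id, Pi.mul_apply, Pi.div_apply]
  have hsq : σ = √σ ^ 2 := (Real.sq_sqrt hσ.le).symm
  have h1 := Real.sin_sq_add_cos_sq (k * √σ)
  generalize √σ = r at *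
  subst hsq
  have hc : Real.cos (k * r) ^ 2 = 1 - Real.sin (k * r) ^ 2 := by linarith
  field_simp
  ring

lemma Qf_contDiffAt (k σ : ℝ) (hk : 0 < k) (hσ : 0 < σ) (h : k * √σ < π) :
    ContDiffAt ℝ 1 (Qf k) σ := by
  have hs : 0 < √σ := Real.sqrt_pos.2 hσ
  have hz : 0 < k * √σ := by positivity
  have hsin := Real.sin_pos_of_pos_of_lt_pi hz h
  have h1 : ContDiffAt ℝ 1 (fun s => k * √s) σ := contDiffAt_const.mul (Real.contDiffAt_sqrt hσ.ne')
  exact ((h1.mul (h1.cos.div h1.sin hsin.ne')).sub contDiffAt_const).div contDiffAt_id hσ.ne'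

lemma riccati (k R1 : ℝ) (hk : 0 < k) (hR1 : 0 < R1) (h : k * R1 < π) :
    ∃ X : Fin 3 → E3 → ℝ, ∀ x : E3, ‖x‖ < R1 → (∀ i, ContDiffAt ℝ 1 (X i) x) ∧
      (∑ i, pd (X i) i x) + ∑ i, (X i x)^2 ≤ -k^2 := by
  have hk1 : R1 < π / k := by rw [lt_div_iff₀ hk]; linarith
  have hk2 : R1^2 < (π/k)^2 := by gcongr
  set δ := (π/k)^2 - R1^2 with hδ
  have hδ0 : 0 < δ := by linarith
  refine ⟨fun i x => x i * Qf k (‖x‖^2 + δ), fun x hx => ?_⟩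
  have hxx : ‖x‖^2 < R1^2 := by gcongr
  have hσ : 0 < ‖x‖^2 + δ := by positivity
  have hkσ : k * √(‖x‖^2 + δ) < π := by
    have : √(‖x‖^2 + δ) < π / k := by
      rw [Real.sqrt_lt' (by positivity)]; linarith
    rw [lt_div_iff₀ hk] at this; linarith
  obtain ⟨q', hq', hric⟩ := Qf_deriv k _ hk hσ hkσ
  have hle := Qf_le k _ hk hσ hkσ
  set σ := ‖x‖^2 + δ with hσd
  have hnorm : ‖x‖^2 = ∑ i, (x i)^2 := by
    rw [EuclideanSpace.norm_sq_eq]; simp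
  refine ⟨fun i => ?_, ?_⟩
  · refine ContDiffAt.mul (by fun_prop) ?_
    exact (Qf_contDiffAt k σ hk hσ hkσ).comp x (f := fun x : E3 => ‖x‖^2 + δ)
      (((contDiff_norm_sq ℝ).contDiffAt).add contDiffAt_const)
  · have hpd : ∀ i, pd (fun x : E3 => x i * Qf k (‖x‖^2 + δ)) i x = Qf k σ + 2 * (x i)^2 * q' := by
      intro i
      have d1 : HasFDerivAt (fun x : E3 => ‖x‖^2 + δ) (2 • innerSL ℝ x) x :=
        (hasStrictFDerivAt_norm_sq x).hasFDerivAt.add_const δ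
      have d2 := hq'.comp_hasFDerivAt x d1
      have d3 : HasFDerivAt (fun x : E3 => x i) (EuclideanSpace.proj i : E3 →L[ℝ] ℝ) x :=
        (EuclideanSpace.proj i : E3 →L[ℝ] ℝ).hasFDerivAt
      have d4 := d3.mul d2
      rw [pd]
      erw [d4.fderiv]
      simp [EuclideanSpace.inner_single_right]
      ring
    simp only [hpd]
    simp only [mul_pow, Finset.sum_add_distrib, ← Finset.sum_mul, ← Finset.mul_sum, ← hnorm]
    simp only [Finset.sum_const, Finset.card_univ, Fintype.card_fin, nsmul_eq_mul]
    have e : ‖x‖^2 = σ - δ := by rw [hσd]; ring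
    rw [e, sub_add_cancel]
    have h3 : 0 ≤ 2 * q' + (Qf k σ)^2 := by
      have : σ * (2 * q' + (Qf k σ)^2) = -k^2 - 3 * Qf k σ := by linarith
      have h4 : 0 ≤ σ * (2 * q' + (Qf k σ)^2) := by rw [this]; linarith
      exact nonneg_of_mul_nonneg_right h4 hσ
    push_cast
    nlinarith [mul_nonneg hδ0.le h3]
lemma pd_mul' {f g : E3 → ℝ} {x : E3} (hf : DifferentiableAt ℝ f x) (hg : DifferentiableAt ℝ g x)
    (i : Fin 3) : pd (fun y => f y * g y) i x = pd f i x * g x + f x * pd g i x := by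
  rw [pd, fderiv_fun_mul hf hg]
  simp [pd]
  ring

lemma pd_add' {f g : E3 → ℝ} {x : E3} (hf : DifferentiableAt ℝ f x) (hg : DifferentiableAt ℝ g x)
    (i : Fin 3) : pd (fun y => f y + g y) i x = pd f i x + pd g i x := by
  rw [pd, fderiv_fun_add hf hg]
  simp [pd]

lemma pd_sub' {f g : E3 → ℝ} {x : E3} (hf : DifferentiableAt ℝ f x) (hg : DifferentiableAt ℝ g x)
    (i : Fin 3) : pd (fun y => f y - g y) i x = pd f i x - pd g i x := by
  rw [pd, fderiv_fun_sub hf hg]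
  simp [pd]

lemma pd_cmul {f : E3 → ℝ} {x : E3} (c : ℝ) (hf : DifferentiableAt ℝ f x)
    (i : Fin 3) : pd (fun y => c * f y) i x = c * pd f i x := by
  rw [pd, fderiv_const_mul hf]
  simp [pd]

lemma energy_alg (d1 d2 δ h p W b X L DW DX Db : ℝ) (hd1 : 0 < d1) (hd2 : 0 < d2)
    (hr : |W - b * h| ≤ δ * h) :
    -(δ^2 / (4 * d2)) * h^2 + h * ((d1 + d2) * L + DW) - d1 * h^2 * (DX + X^2)
      - 1/2 * h^2 * Db ≤
    p * ((d1 + d2) * p + W - d1 * (h * X) - 1/2 * (b * h)) +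
      h * ((d1 + d2) * L + DW - d1 * (p * X + h * DX) - 1/2 * (Db * h + b * p)) := by
  have hr2 : (W - b * h)^2 ≤ (δ * h)^2 := by
    rw [← sq_abs]; gcongr
  have key : -(δ^2 / (4 * d2)) * h^2 ≤ d2 * p^2 + (W - b * h) * p := by
    have e : d2 * p^2 + (W - b * h) * p = d2 * (p + (W - b*h) / (2 * d2))^2 - (W - b * h)^2 / (4 * d2) := by
      field_simp; ring
    have e2 : -(δ^2 / (4 * d2)) * h^2 = - ((δ * h)^2 / (4 * d2)) := by ring
    rw [e, e2]
    have : (W - b * h)^2 / (4 * d2) ≤ (δ * h)^2 / (4 * d2) := by gcongr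
    have : 0 ≤ d2 * (p + (W - b*h) / (2 * d2))^2 := by positivity
    linarith
  nlinarith [mul_nonneg hd1.le (sq_nonneg (p - h * X))]

lemma energy (d1 d2 δ μ k R1 : ℝ) (hd1 : 0 < d1) (hd2 : 0 < d2)
    (hc : μ + 3 * (δ^2 / (4 * d2)) < d1 * k^2)
    (w : E3 → ℝ) (W b X : Fin 3 → E3 → ℝ)
    (hw : ContDiff ℝ 2 w) (hws : HasCompactSupport w) (hwt : tsupport w ⊆ Metric.ball 0 R1)
    (hw0 : ∀ x, 0 ≤ w x)
    (hW : ∀ i, ContDiff ℝ 1 (W i))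
    (hb : ∀ x, ‖x‖ < R1 → (∀ i, ContDiffAt ℝ 1 (b i) x) ∧ ∑ i, pd (b i) i x = 0)
    (hX : ∀ x, ‖x‖ < R1 → (∀ i, ContDiffAt ℝ 1 (X i) x) ∧
      (∑ i, pd (X i) i x) + ∑ i, (X i x)^2 ≤ -k^2)
    (hr : ∀ x, ‖x‖ < R1 → ∀ i, |W i x - b i x * w x| ≤ δ * w x)
    (hpde : ∀ x, 0 ≤ (d1 + d2) * lap w x + ∑ i, pd (W i) i x + μ * w x) :
    ∀ x, w x = 0 := by
  set V : Fin 3 → E3 → ℝ := fun i x => w x * ((d1 + d2) * pd w i x + W i x - d1 * (w x * X i x)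
    - 1/2 * (b i x * w x)) with hV
  have hpw : ∀ i, ContDiff ℝ 1 (pd w i) := fun i =>
    (hw.fderiv_right (m := 1) (by norm_num)).clm_apply contDiff_const
  have hball : ∀ x ∈ tsupport w, ‖x‖ < R1 := fun x hx => by simpa using hwt hx
  have hw1 : ContDiff ℝ 1 w := hw.of_le (by norm_num)
  have hVloc : ∀ x, x ∉ tsupport w → ∀ i, V i =ᶠ[𝓝 x] fun _ => 0 := by
    intro x hx i
    filter_upwards [notMem_tsupport_iff_eventuallyEq.1 hx] with y hy
    simp only [hV, hy]
    simp
  have hVC : ∀ i, ContDiff ℝ 1 (V i) := by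
    intro i
    rw [contDiff_iff_contDiffAt]
    intro x
    by_cases hx : x ∈ tsupport w
    · have h1 := (hb x (hball x hx)).1 i
      have h2 := (hX x (hball x hx)).1 i
      have h3 := hw1.contDiffAt (x := x)
      have h4 := (hpw i).contDiffAt (x := x)
      have h5 := (hW i).contDiffAt (x := x)
      exact h3.mul ((((contDiffAt_const.mul h4).add h5).sub (contDiffAt_const.mul (h3.mul h2))).sub
        (contDiffAt_const.mul (h1.mul h3)))
    · exact (contDiffAt_const (c := (0:ℝ))).congr_of_eventuallyEq (hVloc x hx i)
  have hVs : ∀ i, HasCompactSupport (V i) := fun i => hws.mul_right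
  have hpt : ∀ x, (d1 * k^2 - μ - 3 * (δ^2 / (4 * d2))) * (w x)^2 ≤ ∑ i, pd (V i) i x := by
    intro x
    by_cases hx : x ∈ tsupport w
    · have hxb := hball x hx
      have hpdV : ∀ i, pd (V i) i x = pd w i x * ((d1 + d2) * pd w i x + W i x - d1 * (w x * X i x)
          - 1/2 * (b i x * w x)) + w x * ((d1 + d2) * pd2 w i i x + pd (W i) i x -
          d1 * (pd w i x * X i x + w x * pd (X i) i x) - 1/2 * (pd (b i) i x * w x + b i x * pd w i x)) := by
        intro i
        have h1 := ((hb x hxb).1 i).differentiableAt (by norm_num)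
        have h2 := ((hX x hxb).1 i).differentiableAt (by norm_num)
        have h3 := hw1.contDiffAt (x := x) |>.differentiableAt (by norm_num)
        have h4 := (hpw i).contDiffAt (x := x) |>.differentiableAt (by norm_num)
        have h5 := (hW i).contDiffAt (x := x) |>.differentiableAt (by norm_num)
        have h4' := h4.const_mul (d1 + d2)
        have h32 := h3.fun_mul h2
        have h13 := h1.fun_mul h3
        have h32' := h32.const_mul d1
        have h13' := h13.const_mul (1/2)
        have h45 := h4'.fun_add h5
        have h6 := h45.fun_sub h32'
        have h7 := h6.fun_sub h13'
        simp only [hV]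
        rw [pd_mul' h3 h7, pd_sub' h6 h13', pd_sub' h45 h32', pd_add' h4' h5, pd_cmul _ h4,
          pd_cmul _ h32, pd_cmul _ h13, pd_mul' h3 h2, pd_mul' h1 h3]
        rfl
      have hi : ∀ i, _ := fun i => energy_alg d1 d2 δ (w x) (pd w i x) (W i x) (b i x) (X i x)
        (pd2 w i i x) (pd (W i) i x) (pd (X i) i x) (pd (b i) i x) hd1 hd2 (hr x hxb i)
      have hsum := Finset.sum_le_sum (s := Finset.univ) fun i _ => hi i
      simp only [← hpdV] at hsum
      refine le_trans ?_ hsum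
      have e1 := hpde x
      have e2 := (hX x hxb).2
      have e3 := (hb x hxb).2
      have e4 := hw0 x
      simp only [lap, Fin.sum_univ_three] at e1 e2 e3 ⊢
      have f1 := mul_nonneg e4 e1
      have f2 : 0 ≤ (d1 * (w x)^2) * (-k^2 - (pd (X 0) 0 x + pd (X 1) 1 x + pd (X 2) 2 x +
        ((X 0 x)^2 + (X 1 x)^2 + (X 2 x)^2))) := mul_nonneg (by positivity) (by linarith)
      have f3 : (w x)^2 * (pd (b 0) 0 x + pd (b 1) 1 x + pd (b 2) 2 x) = 0 := by rw [e3]; simp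
      linarith
    · have h0 : w x = 0 := image_eq_zero_of_notMem_tsupport hx
      have : ∀ i, pd (V i) i x = 0 := by
        intro i
        rw [pd, (hVloc x hx i).fderiv_eq]
        simp
      simp [this, h0]
  have hint : Integrable (fun x => (w x)^2) :=
    (hw.continuous.pow 2).integrable_of_hasCompactSupport (by
      simpa [sq] using! hws.mul_right (f' := w))
  have hI : ∫ x, ∑ i, pd (V i) i x = 0 := by
    rw [integral_finsetSum _ fun i _ => (integral_pd (V i) (hVC i) (hVs i) i).1]
    exact Finset.sum_eq_zero fun i _ => (integral_pd (V i) (hVC i) (hVs i) i).2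
  have hle := integral_mono (hint.const_mul (d1 * k^2 - μ - 3 * (δ^2 / (4 * d2))))
    (integrable_finsetSum _ fun i _ => (integral_pd (V i) (hVC i) (hVs i) i).1) hpt
  rw [hI, integral_const_mul] at hle
  have h0 : ∫ x, (w x)^2 = 0 :=
    le_antisymm (by by_contra! h; nlinarith) (integral_nonneg fun x => sq_nonneg _)
  intro x
  by_contra hne
  have h1 := (Continuous.integral_pos_of_hasCompactSupport_nonneg_nonzero (μ := (volume : Measure E3))
    (f := fun x => (w x)^2) (hw.continuous.pow 2) (by
      simpa [sq] using! hws.mul_right (f' := w)) (fun x => sq_nonneg _)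
    (x := x) (by positivity))
  linarith
lemma lap_cont (φ : E3 → ℝ) (hφ : ContDiff ℝ ∞ φ) : Continuous (lap φ) := by
  have : lap φ = fun x => ∑ i, pd (pd φ i) i x := rfl
  rw [this]
  exact continuous_finsetSum _ fun i _ => (pd_contDiff _ (pd_contDiff _ hφ i) i).continuous

def opA (d μ : ℝ) (a : E3 → E3) (φ : E3 → ℝ) (x : E3) : ℝ :=
  -d * lap φ x + ∑ i, a x i * pd φ i x - μ * φ x

lemma opA_contOn (d μ : ℝ) (a : E3 → E3) (K : Set E3) (ha : ContinuousOn a K) (φ : E3 → ℝ)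
    (hφ : ContDiff ℝ ∞ φ) : ContinuousOn (opA d μ a φ) K := by
  unfold opA
  refine ContinuousOn.sub (ContinuousOn.add ?_ ?_) ?_
  · exact (continuous_const.mul (lap_cont φ hφ)).continuousOn
  · refine continuousOn_finsetSum _ fun i _ => ContinuousOn.mul ?_ (pd_contDiff _ hφ i).continuous.continuousOn
    exact (EuclideanSpace.proj i : E3 →L[ℝ] ℝ).continuous.comp_continuousOn ha
  · exact (continuous_const.mul hφ.continuous).continuousOn

lemma pd_smul_add (φ ψ : E3 → ℝ) (hφ : ContDiff ℝ ∞ φ) (hψ : ContDiff ℝ ∞ ψ) (s t : ℝ) (i : Fin 3) :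
    pd (fun y => s * φ y + t * ψ y) i = fun x => s * pd φ i x + t * pd ψ i x := by
  funext x
  have h1 : DifferentiableAt ℝ φ x := hφ.differentiable (by simp) x
  have h2 : DifferentiableAt ℝ ψ x := hψ.differentiable (by simp) x
  rw [pd_add' (h1.const_mul s) (h2.const_mul t), pd_cmul _ h1, pd_cmul _ h2]

lemma opA_smul_add (d μ : ℝ) (a : E3 → E3) (φ ψ : E3 → ℝ) (hφ : ContDiff ℝ ∞ φ)
    (hψ : ContDiff ℝ ∞ ψ) (s t : ℝ) (x : E3) :
    opA d μ a (fun y => s * φ y + t * ψ y) x = s * opA d μ a φ x + t * opA d μ a ψ x := by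
  have h1 : ∀ i, pd2 (fun y => s * φ y + t * ψ y) i i x = s * pd2 φ i i x + t * pd2 ψ i i x := by
    intro i
    unfold pd2
    rw [pd_smul_add φ ψ hφ hψ]
    exact congrFun (pd_smul_add (pd φ i) (pd ψ i) (pd_contDiff _ hφ i) (pd_contDiff _ hψ i) s t i) x
  simp only [opA, lap, h1, pd_smul_add φ ψ hφ hψ, Fin.sum_univ_three]
  ring

lemma duality (d μ : ℝ) (a : E3 → E3) (K : Set E3) (hK : IsCompact K) (hKn : K.Nonempty) (ha : ContinuousOn a K)
    (hno : ¬ ∃ φ : E3 → ℝ, ContDiff ℝ ∞ φ ∧ (∀ x, 0 ≤ φ x) ∧ ∀ x ∈ K, 0 < opA d μ a φ x) :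
    ∃ ν : Measure E3, IsFiniteMeasure ν ∧ ν Kᶜ = 0 ∧ ν ≠ 0 ∧
      ∀ φ : E3 → ℝ, ContDiff ℝ ∞ φ → (∀ x, 0 ≤ φ x) → ∫ x, opA d μ a φ x ∂ν ≤ 0 := by
  have : CompactSpace K := isCompact_iff_compactSpace.1 hK
  have : Nonempty K := hKn.to_subtype
  let P : Set C(K, ℝ) := {p | ∃ φ : E3 → ℝ, ContDiff ℝ ∞ φ ∧ (∀ x, 0 ≤ φ x) ∧ ∀ x : K, p x = opA d μ a φ x}
  let U : Set C(K, ℝ) := {p | ∀ x, 0 < p x}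
  have hU : IsOpen U := by
    have h := ContinuousMap.isOpen_setOfPred_mapsTo (X := K) (Y := ℝ) isCompact_univ isOpen_Ioi (U := Set.Ioi 0)
    convert h using 1
    ext p; simp [U, Set.MapsTo]
  have hUc : Convex ℝ U := by
    intro p hp q hq s t hs ht hst x
    have h1 := hp x
    have h2 := hq x
    simp only [ContinuousMap.add_apply, ContinuousMap.smul_apply, smul_eq_mul]
    rcases hs.eq_or_lt with rfl | hs
    · have : t = 1 := by linarith
      simp [this, h2]
    · have := mul_pos hs h1
      have := mul_nonneg ht h2.le
      linarith
  have hPc : Convex ℝ P := by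
    rintro p ⟨φ, hφ, hφ0, hp⟩ q ⟨ψ, hψ, hψ0, hq⟩ s t hs ht hst
    refine ⟨fun y => s * φ y + t * ψ y, (contDiff_const.mul hφ).add (contDiff_const.mul hψ), fun x => ?_, fun x => ?_⟩
    · have := mul_nonneg hs (hφ0 x)
      have := mul_nonneg ht (hψ0 x)
      linarith
    · rw [opA_smul_add d μ a φ ψ hφ hψ]
      simp [hp, hq]
  have hdis : Disjoint U P := by
    rw [Set.disjoint_left]
    rintro p hp ⟨φ, hφ, hφ0, h⟩
    exact hno ⟨φ, hφ, hφ0, fun x hx => by rw [← h ⟨x, hx⟩]; exact hp _⟩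
  obtain ⟨Λ, s, hΛU, hΛP⟩ := geometric_hahn_banach_open hUc hU hPc hdis
  have hone : (1 : C(K, ℝ)) ∈ U := fun x => by simp
  have hs0 : 0 ≤ s := by
    by_contra! hs
    -- small multiples of one
    have h1 : ∀ e : ℝ, 0 < e → e * Λ 1 < s := fun e he => by
      have := hΛU (e • 1) (fun x => by simp [he])
      simpa using this
    have h2 := h1 1 one_pos
    have h3 : Λ 1 < 0 := by linarith
    have h4 := h1 (s / (2 * Λ 1)) (div_pos_of_neg_of_neg hs (by linarith))
    have hne : Λ 1 ≠ 0 := h3.ne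
    have : s / (2 * Λ 1) * Λ 1 = s / 2 := by field_simp
    linarith
  have hPcone : ∀ p ∈ P, 0 ≤ Λ p := by
    rintro p ⟨φ, hφ, hφ0, hp⟩
    exact hs0.trans (hΛP p ⟨φ, hφ, hφ0, hp⟩)
  have hs1 : s ≤ 0 := by
    have := hΛP 0 ⟨fun _ => 0, contDiff_const, fun _ => le_rfl, fun x => by
      simp [opA, lap, pd2, pd]⟩
    simpa using this
  have hneg : ∀ p ∈ U, Λ p < 0 := fun p hp => (hΛU p hp).trans_le hs1
  have hnonpos : ∀ p : C(K, ℝ), (∀ x, 0 ≤ p x) → Λ p ≤ 0 := by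
    intro p hp
    have h1 := hneg 1 hone
    by_contra! h
    have := hneg (p + (Λ p / (- (2 * Λ 1))) • 1) (fun x => by
      have h2 : 0 < Λ p / (- (2 * Λ 1)) := div_pos h (by linarith)
      have := hp x
      simp only [ContinuousMap.add_apply, ContinuousMap.smul_apply, ContinuousMap.one_apply, smul_eq_mul]
      linarith)
    rw [map_add, map_smul, smul_eq_mul] at this
    have hne : Λ 1 ≠ 0 := h1.ne
    have e : Λ p / (- (2 * Λ 1)) * Λ 1 = - Λ p / 2 := by field_simp
    linarith
  let L0 : CompactlySupportedContinuousMap K ℝ →ₗ[ℝ] ℝ :=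
    { toFun := fun p => - Λ p.toContinuousMap
      map_add' := fun p q => by
        have : (p + q).toContinuousMap = p.toContinuousMap + q.toContinuousMap := rfl
        rw [this, map_add]; ring
      map_smul' := fun c p => by
        have : (c • p).toContinuousMap = c • p.toContinuousMap := rfl
        rw [this, map_smul]; simp }
  let L : CompactlySupportedContinuousMap K ℝ →ₚ[ℝ] ℝ := PositiveLinearMap.mk₀ L0 (fun p hp => by
    have := hnonpos p.toContinuousMap (fun x => hp x)
    change 0 ≤ - Λ p.toContinuousMap
    linarith)
  let νK := RealRMK.rieszMeasure L
  have hrep : ∀ p : C(K, ℝ), ∫ x, p x ∂νK = - Λ p := fun p =>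
    RealRMK.integral_rieszMeasure L (CompactlySupportedContinuousMap.continuousMapEquiv p)
  have hfin : IsFiniteMeasure νK := by
    refine ⟨?_⟩
    have := RealRMK.rieszMeasure_le_of_eq_one L (f := CompactlySupportedContinuousMap.continuousMapEquiv (1 : C(K,ℝ)))
      (fun x => by simp) (K := Set.univ) isCompact_univ (fun x _ => by simp)
    exact this.trans_lt ENNReal.ofReal_lt_top
  have hemb : MeasurableEmbedding (Subtype.val : K → E3) := MeasurableEmbedding.subtype_coe hK.measurableSet
  refine ⟨νK.map Subtype.val, ?_, ?_, ?_, ?_⟩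
  · exact Measure.isFiniteMeasure_map νK _
  · rw [hemb.map_apply]
    simp
  · intro h
    have h1 : νK = 0 := (Measure.map_eq_zero_iff hemb.measurable.aemeasurable).1 h
    have h2 := hrep 1
    rw [h1] at h2
    have := hneg 1 hone
    simp at h2
    linarith
  · intro φ hφ hφ0
    rw [hemb.integral_map]
    let p : C(K, ℝ) := ⟨fun x => opA d μ a φ x, (opA_contOn d μ a K ha φ hφ).domRestrict⟩
    have h1 := hrep p
    have h2 := hPcone p ⟨φ, hφ, hφ0, fun x => rfl⟩
    have h3 : ∫ x : K, opA d μ a φ x ∂νK = - Λ p := h1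
    linarith
lemma pd_refl (η : E3 → ℝ) (hη : ContDiff ℝ ∞ η) (x : E3) (i : Fin 3) :
    pd (fun y => η (x - y)) i = fun y => - pd η i (x - y) := by
  funext y
  have h1 : HasFDerivAt η (fderiv ℝ η (x - y)) (x - y) :=
    (hη.differentiable (by simp) _).hasFDerivAt
  have h2 : HasFDerivAt (fun z : E3 => x - z) (-ContinuousLinearMap.id ℝ E3) y :=
    (hasFDerivAt_id y).const_sub x
  have h3 := h1.comp y h2
  have h4 : HasFDerivAt (fun y => η (x - y)) _ y := h3
  rw [pd, h4.fderiv]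
  simp [pd]

lemma opA_refl (d μ : ℝ) (a : E3 → E3) (η : E3 → ℝ) (hη : ContDiff ℝ ∞ η) (x y : E3) :
    opA d μ a (fun y => η (x - y)) y = 
      -d * (∑ i, pd (pd η i) i (x - y)) - (∑ i, a y i * pd η i (x - y)) - μ * η (x - y) := by
  have h1 : ∀ i, pd2 (fun y => η (x - y)) i i y = pd (pd η i) i (x - y) := by
    intro i
    unfold pd2
    rw [pd_refl η hη]
    have hd : DifferentiableAt ℝ (fun y => pd η i (x - y)) y := by
      have := pd_contDiff η hη i
      have : ContDiff ℝ ∞ (fun y => pd η i (x - y)) := this.comp (contDiff_const.sub contDiff_id)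
      exact this.differentiable (by simp) y
    have h2 := pd_cmul (-1) hd i
    have h3 := congrFun (pd_refl (pd η i) (pd_contDiff η hη i) x i) y
    rw [h3] at h2
    simpa using h2
  simp only [opA, lap, h1, pd_refl η hη, Fin.sum_univ_three]
  ring

lemma no_measure (d R μ : ℝ) (hd : 0 < d) (hR : 0 < R) (hμ : 0 < μ) (hlt : μ * R^2 < d * π^2)
    (a : E3 → E3) (ha : ContDiffOn ℝ 1 a (Metric.closedBall 0 R))
    (hdiv : ∀ x ∈ Metric.ball (0:E3) R, (∑ i, pd (fun y => a y i) i x) = 0)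
    (ν : Measure E3) [IsFiniteMeasure ν] (hν : ν (Metric.closedBall 0 R)ᶜ = 0)
    (h : ∀ φ : E3 → ℝ, ContDiff ℝ ∞ φ → (∀ x, 0 ≤ φ x) → ∫ x, opA d μ a φ x ∂ν ≤ 0) : ν = 0 := by
  have hKae : ∀ᵐ y ∂ν, y ∈ Metric.closedBall (0:E3) R := hν
  have hK : IsCompact (Metric.closedBall (0:E3) R) := isCompact_closedBall _ _
  -- parameters
  have hπ := pi_pos
  obtain ⟨d1, hd1, hd1d, hd1lt⟩ : ∃ d1, 0 < d1 ∧ d1 < d ∧ μ * R^2 < d1 * π^2 := by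
    have h1 : μ * R^2 / π^2 < d := by rw [div_lt_iff₀ (by positivity)]; exact hlt
    obtain ⟨d1, h2, h3⟩ := exists_between h1
    refine ⟨d1, lt_trans (by positivity) h2, h3, ?_⟩
    rwa [div_lt_iff₀ (by positivity)] at h2
  obtain ⟨k, hk, hkμ, hkR⟩ : ∃ k, 0 < k ∧ μ < d1 * k^2 ∧ k * R < π := by
    have h1 : μ / d1 < (π / R)^2 := by
      rw [div_pow, div_lt_div_iff₀ hd1 (by positivity)]; linarith
    have h1' : √(μ / d1) < π / R := by
      rw [Real.sqrt_lt' (by positivity)]; exact h1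
    obtain ⟨k, h2, h3⟩ := exists_between h1'
    have hk : 0 < k := lt_of_le_of_lt (Real.sqrt_nonneg _) h2
    refine ⟨k, hk, ?_, ?_⟩
    · rw [Real.sqrt_lt' hk, div_lt_iff₀ hd1] at h2
      linarith
    · rwa [lt_div_iff₀ hR] at h3
  set d2 := d - d1 with hd2d
  have hd2 : 0 < d2 := by linarith
  have hdd : d = d1 + d2 := by rw [hd2d]; ring
  obtain ⟨δ, hδ, hδc⟩ : ∃ δ, 0 < δ ∧ μ + 3 * (δ^2 / (4 * d2)) < d1 * k^2 := by
    have hc : 0 < d1 * k^2 - μ := by linarith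
    refine ⟨√((d1 * k^2 - μ) * d2), by positivity, ?_⟩
    rw [Real.sq_sqrt (by positivity)]
    have : (d1 * k^2 - μ) * d2 / (4 * d2) = (d1 * k^2 - μ) / 4 := by field_simp
    rw [this]; linarith
  obtain ⟨e0, he0, hunif⟩ := Metric.uniformContinuousOn_iff.1
    (hK.uniformContinuousOn_of_continuous ha.continuousOn) δ hδ
  obtain ⟨R1, hR1, hkR1, hR1e⟩ : ∃ R1, R < R1 ∧ k * R1 < π ∧ R1 - R ≤ e0 / 2 := by
    have h1 : R < min (π / k) (R + e0 / 2) := by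
      refine lt_min ?_ (by linarith)
      rw [lt_div_iff₀ hk]; linarith
    obtain ⟨R1, h2, h3⟩ := exists_between h1
    have h4 := h3.trans_le (min_le_left _ _)
    have h5 := h3.trans_le (min_le_right _ _)
    refine ⟨R1, h2, ?_, by linarith⟩
    rw [lt_div_iff₀ hk] at h4; linarith
  have hR10 : 0 < R1 := hR.trans hR1
  set ε := (R1 - R) / 2 with hε
  have hε0 : 0 < ε := by rw [hε]; linarith
  obtain ⟨X, hX⟩ := riccati k R1 hk hR10 hkR1
  -- mollifier
  let B : ContDiffBump (0:E3) := ⟨ε/2, ε, by linarith, by linarith⟩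
  set η : E3 → ℝ := fun x => B x with hηd
  have hη : ContDiff ℝ ∞ η := B.contDiff
  have hηs : HasCompactSupport η := B.hasCompactSupport
  have hη0 : ∀ x, 0 ≤ η x := fun x => B.nonneg
  have hηsupp : ∀ x, η x ≠ 0 ↔ ‖x‖ < ε := by
    intro x
    have := B.support_eq
    rw [← Function.mem_support]
    have h2 : Function.support η = Metric.ball 0 ε := this
    rw [h2]; simp
  have hai : ∀ i, Integrable (fun y => a y i) ν := by
    intro i
    have h1 : ContinuousOn (fun y => a y i) (Metric.closedBall (0:E3) R) :=
      (EuclideanSpace.proj i : E3 →L[ℝ] ℝ).continuous.comp_continuousOn ha.continuousOn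
    have h2 : IntegrableOn (fun y => a y i) (Metric.closedBall (0:E3) R) ν := h1.integrableOn_compact hK
    have h3 : ν.restrict (Metric.closedBall (0:E3) R) = ν := Measure.restrict_eq_self_of_ae_mem hKae
    rwa [IntegrableOn, h3] at h2
  have h1i : Integrable (fun _ : E3 => (1:ℝ)) ν := integrable_const 1
  set w : E3 → ℝ := Tc ν (fun _ => 1) η with hw
  set W : Fin 3 → E3 → ℝ := fun i => Tc ν (fun y => a y i) η with hWd
  set s := R / R1 with hs
  have hs0 : 0 < s := by positivity
  set b : Fin 3 → E3 → ℝ := fun i x => a (s • x) i with hb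
  have hw0 : ∀ x, 0 ≤ w x := fun x => integral_nonneg fun y => by
    simpa using hη0 _
  have hwz : ∀ x, R + ε < ‖x‖ → w x = 0 := by
    intro x hx
    refine integral_eq_zero_of_ae ?_
    filter_upwards [hKae] with y hy
    have hy' : ‖y‖ ≤ R := by simpa using hy
    have : η (x - y) = 0 := by
      by_contra hne
      have h1 := (hηsupp _).1 hne
      have h2 := norm_sub_norm_le x y
      linarith
    simp [this]
  have hsub : Function.support w ⊆ Metric.closedBall 0 (R + ε) := by
    intro x hx
    by_contra hne
    exact hx (hwz x (by simpa using hne))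
  have hws : HasCompactSupport w := HasCompactSupport.of_support_subset_isCompact (isCompact_closedBall _ _) hsub
  have hwt : tsupport w ⊆ Metric.ball 0 R1 :=
    (closure_minimal hsub Metric.isClosed_closedBall).trans
      (Metric.closedBall_subset_ball (by rw [hε]; linarith))
  have hzero : ∀ x, w x = 0 := by
    refine energy d1 d2 δ μ k R1 hd1 hd2 hδc w W b X (Tc_contDiff 2 ν _ h1i η hη hηs) hws hwt hw0
      (fun i => by exact_mod_cast Tc_contDiff 1 ν _ (hai i) η hη hηs) ?_ hX ?_ ?_
    · intro x hx
      have hsx : s • x ∈ Metric.ball (0:E3) R := by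
        rw [mem_ball_zero_iff, norm_smul, Real.norm_of_nonneg hs0.le]
        calc s * ‖x‖ < s * R1 := by gcongr
          _ = R := by rw [hs]; field_simp
      have hca : ContDiffAt ℝ 1 a (s • x) := ha.contDiffAt
        (Filter.mem_of_superset (Metric.isOpen_ball.mem_nhds hsx) Metric.ball_subset_closedBall)
      have hcai : ∀ i, ContDiffAt ℝ 1 (fun y => a y i) (s • x) := fun i =>
        ((EuclideanSpace.proj i : E3 →L[ℝ] ℝ).contDiff.contDiffAt).comp (s • x) hca
      refine ⟨fun i => (hcai i).comp x (by fun_prop : ContDiffAt ℝ 1 (fun x : E3 => s • x) x), ?_⟩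
      have : ∀ i, pd (b i) i x = s * pd (fun y => a y i) i (s • x) := by
        intro i
        have h1 := ((hcai i).differentiableAt (by norm_num)).hasFDerivAt
        have h2 : HasFDerivAt (fun x : E3 => s • x) (s • ContinuousLinearMap.id ℝ E3) x :=
          (hasFDerivAt_id x).const_smul s
        have h3 : HasFDerivAt (b i) _ x := h1.comp x h2
        rw [pd, h3.fderiv]
        simp [pd]
      simp only [this, ← Finset.mul_sum, hdiv _ hsx, mul_zero]
    · intro x hx i
      have i1 := Tc_int ν _ (hai i) η hη.continuous hηs x
      have i2 := Tc_int ν _ h1i η hη.continuous hηs x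
      have e1 : W i x - b i x * w x = ∫ y, (a y i - b i x) * η (x - y) ∂ν := by
        have h1 : b i x * w x = ∫ y, b i x * ((1:ℝ) • η (x - y)) ∂ν := (integral_const_mul _ _).symm
        have h2 : W i x = ∫ y, a y i • η (x - y) ∂ν := rfl
        rw [h1, h2, ← integral_sub i1 (i2.const_mul _)]
        congr 1
        funext y
        simp only [smul_eq_mul]; ring
      have e2 : δ * w x = ∫ y, δ * ((1:ℝ) • η (x - y)) ∂ν := (integral_const_mul _ _).symm
      rw [e1, e2, ← Real.norm_eq_abs]
      refine norm_integral_le_of_norm_le (i2.const_mul _) ?_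
      filter_upwards [hKae] with y hy
      rw [norm_mul, Real.norm_of_nonneg (hη0 _), one_smul]
      by_cases hne : η (x - y) = 0
      · simp [hne]
      · have h1 := (hηsupp _).1 hne
        refine mul_le_mul_of_nonneg_right ?_ (hη0 _)
        have hsR : s * R1 = R := by rw [hs]; field_simp
        have hs1 : s < 1 := by rw [hs, div_lt_one hR10]; exact hR1
        have hsx : s • x ∈ Metric.closedBall (0:E3) R := by
          rw [mem_closedBall_zero_iff, norm_smul, Real.norm_of_nonneg hs0.le]
          nlinarith
        have hdist : dist y (s • x) < e0 := by
          rw [dist_eq_norm]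
          have e : y - s • x = -(x - y) + (1 - s) • x := by
            rw [sub_smul, one_smul]; abel
          rw [e]
          have h2 := norm_add_le (-(x - y)) ((1 - s) • x)
          rw [norm_neg, norm_smul, Real.norm_of_nonneg (by linarith)] at h2
          have h3 : (1 - s) * ‖x‖ ≤ (1 - s) * R1 := mul_le_mul_of_nonneg_left hx.le (by linarith)
          have h4 : (1 - s) * R1 = R1 - R := by rw [sub_mul, hsR, one_mul]
          linarith
        have h2 := hunif y hy _ hsx hdist
        rw [dist_eq_norm] at h2
        have h3 : a y i - b i x = (a y - a (s • x)) i := rfl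
        rw [h3]
        exact (PiLp.norm_apply_le _ i).trans h2.le
    · intro x
      have hx := h (fun y => η (x - y)) (hη.comp (contDiff_const.sub contDiff_id)) (fun y => hη0 _)
      have hpη := fun i => pd_contDiff η hη i
      have hpηs := fun i => pd_compact η hηs i
      have hl : lap w x = ∑ i, Tc ν (fun _ => 1) (pd (pd η i) i) x := by
        refine Finset.sum_congr rfl fun i _ => ?_
        have e1 : (fun y => pd w i y) = Tc ν (fun _ => 1) (pd η i) := Tc_pd ν _ h1i η hη hηs i
        rw [pd2, e1, Tc_pd ν _ h1i _ (hpη i) (hpηs i) i]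
      have hWi : ∀ i, pd (W i) i x = Tc ν (fun y => a y i) (pd η i) x := fun i =>
        congrFun (Tc_pd ν _ (hai i) η hη hηs i) x
      have j1 := Tc_int ν _ h1i η hη.continuous hηs x
      have j2 := fun i => Tc_int ν _ h1i _ (pd_contDiff _ (hpη i) i).continuous (pd_compact _ (hpηs i) i) x
      have j3 := fun i => Tc_int ν _ (hai i) _ (hpη i).continuous (hpηs i) x
      have e : ∫ y, opA d μ a (fun y => η (x - y)) y ∂ν =
          -d * (∑ i, Tc ν (fun _ => 1) (pd (pd η i) i) x) - (∑ i, Tc ν (fun y => a y i) (pd η i) x)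
            - μ * w x := by
        simp only [opA_refl d μ a η hη]
        simp only [smul_eq_mul, one_mul] at j1 j2 j3
        have k2 := integrable_finsetSum Finset.univ fun i _ => j2 i
        have k3 := integrable_finsetSum Finset.univ fun i _ => j3 i
        have k4 : Integrable (fun y => -d * (∑ i, pd (pd η i) i (x - y)) - ∑ i, a y i * pd η i (x - y)) ν := (k2.const_mul _).sub k3
        rw [integral_sub k4 (j1.const_mul _), integral_sub (k2.const_mul _) k3,
          integral_const_mul, integral_const_mul, integral_finsetSum _ fun i _ => j2 i,
          integral_finsetSum _ fun i _ => j3 i]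
        simp [Tc, hw]
      rw [e] at hx
      rw [hl, ← hdd]
      simp only [hWi]
      linarith
  -- conclude
  rw [← Measure.measure_univ_eq_zero]
  refine measure_null_of_locally_null _ fun x _ => ⟨Metric.ball x ε, mem_nhdsWithin_of_mem_nhds (Metric.ball_mem_nhds x hε0), ?_⟩
  have h1 := hzero x
  have i2 := Tc_int ν _ h1i η hη.continuous hηs x
  have h2 := (integral_eq_zero_iff_of_nonneg (fun y => by simpa using hη0 _) i2).1 h1
  refine measure_mono_null ?_ h2
  intro y hy
  have : η (x - y) ≠ 0 := (hηsupp _).2 (by rw [← dist_eq_norm, dist_comm]; exact hy)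
  simpa using this

lemma exists_super (d R μ : ℝ) (hd : 0 < d) (hR : 0 < R) (hμ : 0 < μ) (hlt : μ * R^2 < d * π^2)
    (a : E3 → E3) (ha : ContDiffOn ℝ 1 a (Metric.closedBall 0 R))
    (hdiv : ∀ x ∈ Metric.ball (0:E3) R, (∑ i, pd (fun y => a y i) i x) = 0) :
    ∃ φ : E3 → ℝ, ContDiff ℝ ∞ φ ∧ (∀ x, 0 < φ x) ∧
      ∀ x ∈ Metric.closedBall (0:E3) R, 0 < opA d μ a φ x := by
  have hK : IsCompact (Metric.closedBall (0:E3) R) := isCompact_closedBall _ _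
  have hKn : (Metric.closedBall (0:E3) R).Nonempty := ⟨0, by simp [hR.le]⟩
  have hex : ∃ φ : E3 → ℝ, ContDiff ℝ ∞ φ ∧ (∀ x, 0 ≤ φ x) ∧
      ∀ x ∈ Metric.closedBall (0:E3) R, 0 < opA d μ a φ x := by
    by_contra hno
    obtain ⟨ν, h1, h2, h3, h4⟩ := duality d μ a _ hK hKn ha.continuousOn hno
    exact h3 (no_measure d R μ hd hR hμ hlt a ha hdiv ν h2 h4)
  obtain ⟨φ, hφ, hφ0, hop⟩ := hex
  obtain ⟨x0, hx0, hmin⟩ := hK.exists_isMinOn hKn (opA_contOn d μ a _ ha.continuousOn φ hφ)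
  set c := opA d μ a φ x0 with hc
  have hc0 : 0 < c := hop x0 hx0
  have hone : ∀ x, opA d μ a (fun _ => (1:ℝ)) x = -μ := fun x => by simp [opA, lap, pd2, pd]
  refine ⟨fun y => 1 * φ y + (c / (2 * μ)) * (fun _ => (1:ℝ)) y, ?_, fun x => ?_, fun x hx => ?_⟩
  · exact (contDiff_const.mul hφ).add (contDiff_const.mul contDiff_const)
  · have := hφ0 x
    have : 0 < c / (2 * μ) := by positivity
    simp only [one_mul, mul_one]; linarith
  · rw [opA_smul_add d μ a φ _ hφ contDiff_const, hone]
    have h1 : c ≤ opA d μ a φ x := hmin hx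
    have : c / (2 * μ) * -μ = -c/2 := by field_simp
    rw [this]; linarith
lemma pd2_nonpos {h : E3 → ℝ} {x0 : E3} (hc : ContDiffAt ℝ 2 h x0) (hm : IsLocalMax h x0)
    (i : Fin 3) : pd2 h i i x0 ≤ 0 := by
  set e : E3 := EuclideanSpace.single i 1 with he
  let l : ℝ → E3 := fun s => x0 + s • e
  have hl : ∀ s, HasDerivAt l e s := fun s => by
    have := ((hasDerivAt_id s).smul_const e).const_add x0
    simpa [l] using this
  have l0 : l 0 = x0 := by simp [l]
  have lt : Tendsto l (𝓝 0) (𝓝 x0) := by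
    have := (hl 0).continuousAt.tendsto
    rwa [l0] at this
  have ev : ∀ᶠ y in 𝓝 x0, DifferentiableAt ℝ h y := by
    have := hc.eventually (by simp)
    exact this.mono fun y hy => hy.differentiableAt (by norm_num)
  have ev2 : ∀ᶠ s in 𝓝 (0:ℝ), deriv (h ∘ l) s = (fun y => pd h i y) (l s) := by
    filter_upwards [lt.eventually ev] with s hs
    exact (hs.hasFDerivAt.comp_hasDerivAt s (hl s)).deriv
  have hpd : DifferentiableAt ℝ (fun y => pd h i y) x0 := by
    have h1 : ContDiffAt ℝ 1 (fderiv ℝ h) x0 := hc.fderiv_right (by norm_num)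
    exact (h1.differentiableAt (by norm_num)).clm_apply (differentiableAt_const _)
  have hdd : deriv (deriv (h ∘ l)) 0 = pd2 h i i x0 := by
    rw [Filter.EventuallyEq.deriv_eq (f := fun s => (fun y => pd h i y) (l s)) ev2]
    have h2 : HasFDerivAt (fun y => pd h i y) (fderiv ℝ (fun y => pd h i y) x0) (l 0) := by
      rw [l0]; exact hpd.hasFDerivAt
    exact (h2.comp_hasDerivAt 0 (hl 0)).deriv
  by_contra hcon
  push Not at hcon
  have hk : IsLocalMax (h ∘ l) 0 := by
    have := lt.eventually hm
    filter_upwards [this] with s hs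
    simpa [l0] using hs
  have hmin : IsLocalMin (h ∘ l) 0 := by
    apply isLocalMin_of_deriv_deriv_pos (by rw [hdd]; exact hcon) hk.deriv_eq_zero
    apply ContinuousAt.comp _ (hl 0).continuousAt
    rw [l0]; exact hc.continuousAt
  have heq : (h ∘ l) =ᶠ[𝓝 0] fun _ => (h ∘ l) 0 := by
    filter_upwards [hk, hmin] with s h1 h2
    exact le_antisymm h1 h2
  have := heq.deriv.deriv_eq
  rw [hdd] at this
  simp at this
  linarith

lemma cmp_max {v φ : E3 → ℝ} {x0 : E3} {c : ℝ} (hv : ContDiffAt ℝ 2 v x0) (hφ : ContDiff ℝ 2 φ)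
    (hm : IsLocalMax (fun y => v y - c * φ y) x0) (i : Fin 3) :
    pd v i x0 = c * pd φ i x0 ∧ pd2 v i i x0 ≤ c * pd2 φ i i x0 := by
  have hcφ : ContDiff ℝ 2 (fun y => c * φ y) := contDiff_const.mul hφ
  have hd : ContDiffAt ℝ 2 (fun y => v y - c * φ y) x0 := hv.sub hcφ.contDiffAt
  have key : ∀ y, DifferentiableAt ℝ v y →
      pd (fun y => v y - c * φ y) i y = pd v i y - c * pd φ i y := by
    intro y hy
    have h1 : HasFDerivAt φ (fderiv ℝ φ y) y := (hφ.differentiable (by norm_num) y).hasFDerivAt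
    have h2 : HasFDerivAt (fun y => v y - c * φ y) (fderiv ℝ v y - c • fderiv ℝ φ y) y :=
      hy.hasFDerivAt.sub (h1.const_mul c)
    unfold pd
    rw [h2.fderiv]; simp
  have hdv : DifferentiableAt ℝ v x0 := hv.differentiableAt (by norm_num)
  refine ⟨?_, ?_⟩
  · have h0 := key x0 hdv
    have : pd (fun y => v y - c * φ y) i x0 = 0 := by
      unfold pd; rw [hm.fderiv_eq_zero]; simp
    linarith
  · have h0 := pd2_nonpos hd hm i
    have ev : (fun y => pd (fun y => v y - c * φ y) i y) =ᶠ[𝓝 x0]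
        fun y => pd v i y - c * pd φ i y := by
      have := hv.eventually (by simp)
      filter_upwards [this] with y hy
      exact key y (hy.differentiableAt (by norm_num))
    have hpv : DifferentiableAt ℝ (fun y => pd v i y) x0 := by
      have h1 : ContDiffAt ℝ 1 (fderiv ℝ v) x0 := hv.fderiv_right (by norm_num)
      exact (h1.differentiableAt (by norm_num)).clm_apply (differentiableAt_const _)
    have hpφ : DifferentiableAt ℝ (fun y => pd φ i y) x0 := by
      have h1 : ContDiffAt ℝ 1 (fderiv ℝ φ) x0 := hφ.contDiffAt.fderiv_right (by norm_num)
      exact (h1.differentiableAt (by norm_num)).clm_apply (differentiableAt_const _)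
    have h3 : HasFDerivAt (fun y => pd v i y - c * pd φ i y)
      (fderiv ℝ (fun y => pd v i y) x0 - c • fderiv ℝ (fun y => pd φ i y) x0) x0 :=
      hpv.hasFDerivAt.sub (hpφ.hasFDerivAt.const_mul c)
    have h4 : pd2 (fun y => v y - c * φ y) i i x0 = pd2 v i i x0 - c * pd2 φ i i x0 := by
      change fderiv ℝ (fun y => pd (fun y => v y - c * φ y) i y) x0 (EuclideanSpace.single i 1) = _
      rw [Filter.EventuallyEq.fderiv_eq ev, h3.fderiv]
      rfl
    linarith

lemma left_deriv_nonneg {w : ℝ → ℝ} {t w' : ℝ} (ht : 0 < t) (hw : HasDerivAt w w' t)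
    (hle : ∀ s ∈ Set.Icc 0 t, w s ≤ w t) : 0 ≤ w' := by
  have h1 : Tendsto (slope w t) (𝓝[<] t) (𝓝 w') := by
    have := hasDerivAt_iff_tendsto_slope.1 hw
    exact this.mono_left (nhdsWithin_mono _ (fun s hs => ne_of_lt hs))
  refine ge_of_tendsto h1 ?_
  filter_upwards [Ioo_mem_nhdsLT ht] with s hs
  rw [slope_def_field]
  exact div_nonneg_of_nonpos (by linarith [hle s ⟨hs.1.le, hs.2.le⟩]) (by linarith [hs.2])

lemma step (d R μ F G : ℝ) (hd : 0 < d) (hR : 0 < R) (hG : 0 < G)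
    (a : E3 → E3) (f g : ℝ → ℝ) (hf : ∀ N, 0 ≤ N → f N ≤ F * N) (hg : ∀ N, 0 ≤ N → g N ≤ G * N)
    (sol : ImpSol 3 (Metric.ball (0:E3) R) d a f g)
    (φ : E3 → ℝ) (hφ : ContDiff ℝ 2 φ) (hp : ∀ x, 0 < φ x)
    (hop : ∀ x ∈ Metric.closedBall (0:E3) R, 0 < opA d μ a φ x)
    (m : ℕ) (M : ℝ) (hM : 0 ≤ M) (hN : ∀ x ∈ Metric.closedBall (0:E3) R, sol.N m x ≤ M * φ x) :
    ∀ x ∈ Metric.closedBall (0:E3) R, sol.N (m+1) x ≤ (G * Real.exp (F - μ)) * M * φ x := by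
  have hcl : closure (Metric.ball (0:E3) R) = Metric.closedBall 0 R := closure_ball _ hR.ne'
  have hfr : frontier (Metric.ball (0:E3) R) = Metric.sphere 0 R := frontier_ball _ hR.ne'
  have hin : ∀ x ∈ Metric.closedBall (0:E3) R, x ∉ Metric.ball (0:E3) R →
      x ∈ frontier (Metric.ball (0:E3) R) := by
    intro x h1 h2
    rw [hfr]
    rw [Metric.mem_sphere]
    exact le_antisymm h1 (not_lt.1 h2)
  set u := sol.u m with hu
  set L := F - μ with hL
  have ucont := sol.u_cont m
  have unn := sol.u_nonneg m
  have nn := sol.N_nonneg m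
  rw [hcl] at ucont unn nn
  have huc : ContinuousOn (fun p : E3 × ℝ => u p.1 p.2 * Real.exp (-L * p.2) / φ p.1)
      (Metric.closedBall (0:E3) R ×ˢ Set.Icc (0:ℝ) 1) := by
    apply ContinuousOn.div
    · apply ucont.mul
      fun_prop
    · exact (hφ.continuous.comp continuous_fst).continuousOn
    · intro p _; exact (hp _).ne'
  have hK : IsCompact (Metric.closedBall (0:E3) R ×ˢ Set.Icc (0:ℝ) 1) :=
    (isCompact_closedBall _ _).prod isCompact_Icc
  obtain ⟨⟨x0, t0⟩, ⟨hx0, ht0⟩, hmax⟩ := hK.exists_isMaxOn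
    ⟨((0:E3), (0:ℝ)), ⟨Metric.mem_closedBall_self hR.le, by simp⟩⟩ huc
  change x0 ∈ _ at hx0
  change t0 ∈ _ at ht0
  set C := u x0 t0 * Real.exp (-L * t0) / φ x0 with hC
  have hle : ∀ x ∈ Metric.closedBall (0:E3) R, ∀ t ∈ Set.Icc (0:ℝ) 1,
      u x t * Real.exp (-L * t) / φ x ≤ C := fun x hx t ht => hmax (Set.mk_mem_prod hx ht)
  have hle' : ∀ x ∈ Metric.closedBall (0:E3) R, ∀ t ∈ Set.Icc (0:ℝ) 1,
      u x t ≤ C * Real.exp (L * t) * φ x := by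
    intro x hx t ht
    have h1 := hle x hx t ht
    rw [div_le_iff₀ (hp x), neg_mul, Real.exp_neg, ← div_eq_mul_inv,
      div_le_iff₀ (Real.exp_pos _)] at h1
    linarith
  have heq : u x0 t0 = C * Real.exp (L * t0) * φ x0 := by
    rw [hC, neg_mul, Real.exp_neg]
    have := (hp x0).ne'
    have := (Real.exp_pos (L * t0)).ne'
    field_simp
  have main : C ≤ G * M := by
    by_contra hcon
    push Not at hcon
    have hCpos : 0 < C := lt_of_le_of_lt (by positivity) hcon
    have hupos : 0 < u x0 t0 := by
      rw [heq]; have := hp x0; positivity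
    have hxin : x0 ∈ Metric.ball (0:E3) R := by
      by_contra hx
      have hb := sol.bdry m x0 (hin x0 hx0 hx)
      have hct : ContinuousOn (fun t => u x0 t) (Set.Icc (0:ℝ) 1) := by
        have : ContinuousOn (fun t : ℝ => (x0, t)) (Set.Icc (0:ℝ) 1) := by fun_prop
        exact ucont.comp this (fun t ht => ⟨hx0, ht⟩)
      have hz : ∀ t ∈ Set.Icc (0:ℝ) 1, u x0 t = 0 := by
        have hcl2 : closure (Set.Ioc (0:ℝ) 1) = Set.Icc 0 1 := closure_Ioc (by norm_num)
        have : Set.EqOn (fun t => u x0 t) (fun _ => 0) (Set.Icc (0:ℝ) 1) := by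
          refine Set.EqOn.of_subset_closure (s := Set.Ioc (0:ℝ) 1) ?_ hct continuousOn_const
            Set.Ioc_subset_Icc_self hcl2.ge
          intro t ht; exact hb t ht
        exact this
      rw [hz t0 ht0] at hupos
      exact lt_irrefl _ hupos
    have ht0' : 0 < t0 := by
      rcases ht0.1.lt_or_eq with h | h
      · exact h
      exfalso
      have h1 := sol.init m x0 hxin
      have h2 := hg _ (nn x0 hx0)
      have h3 := hN x0 hx0
      rw [← h] at heq
      simp only [mul_zero, Real.exp_zero, mul_one] at heq
      have h4 : G * sol.N m x0 ≤ G * (M * φ x0) := mul_le_mul_of_nonneg_left h3 hG.le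
      have h5 : u x0 0 = g (sol.N m x0) := h1
      have h6 := mul_lt_mul_of_pos_right hcon (hp x0)
      nlinarith
    have htI : t0 ∈ Set.Ioc (0:ℝ) 1 := ⟨ht0', ht0.2⟩
    have hpde := sol.pde m x0 hxin t0 htI
    have hdt := ((sol.u_time_C1 m x0 hxin t0 htI).differentiableAt (by norm_num)).hasDerivAt
    set c := C * Real.exp (L * t0) with hc
    have hcpos : 0 < c := by positivity
    have hloc : IsLocalMax (fun y => u y t0 - c * φ y) x0 := by
      have hb : Metric.ball (0:E3) R ∈ 𝓝 x0 := Metric.isOpen_ball.mem_nhds hxin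
      filter_upwards [hb] with y hy
      have := hle' y (Metric.ball_subset_closedBall hy) t0 ht0
      have e0 : u x0 t0 - c * φ x0 = 0 := by rw [heq]; ring
      rw [e0]; linarith
    have hcmp := cmp_max (sol.u_space_C2 m t0 htI x0 hxin) hφ hloc
    have hlap : lap (fun y => u y t0) x0 ≤ c * lap φ x0 := by
      unfold lap
      rw [Finset.mul_sum]
      exact Finset.sum_le_sum fun i _ => (hcmp i).2
    have hgrad : (∑ i, a x0 i * pd (fun y => u y t0) i x0) = c * ∑ i, a x0 i * pd φ i x0 := by
      rw [Finset.mul_sum]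
      refine Finset.sum_congr rfl fun i _ => ?_
      have : pd (fun y => u y t0) i x0 = c * pd φ i x0 := (hcmp i).1
      rw [this]; ring
    have hwd : HasDerivAt (fun s => u x0 s * Real.exp (-L * s))
        (deriv (fun s => u x0 s) t0 * Real.exp (-L * t0) +
          u x0 t0 * (Real.exp (-L * t0) * -L)) t0 := by
      refine hdt.mul ?_
      have : HasDerivAt (fun s : ℝ => -L * s) (-L) t0 := by
        simpa using (hasDerivAt_id t0).const_mul (-L)
      exact this.exp
    have hge := left_deriv_nonneg ht0' hwd (by
      intro s hs
      have h1 := hle x0 hx0 s ⟨hs.1, hs.2.trans ht0.2⟩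
      rw [hC] at h1
      exact (div_le_div_iff_of_pos_right (hp x0)).1 h1)
    have hge2 : 0 ≤ deriv (fun s => u x0 s) t0 - L * u x0 t0 := by
      have : 0 ≤ (deriv (fun s => u x0 s) t0 - L * u x0 t0) * Real.exp (-L * t0) := by
        nlinarith
      exact nonneg_of_mul_nonneg_left this (Real.exp_pos _)
    have hfu := hf _ hupos.le
    have hopx := hop x0 hx0
    unfold opA at hopx
    have hpde' : deriv (fun s => u x0 s) t0 = d * lap (fun y => u y t0) x0
      - (∑ i, a x0 i * pd (fun y => u y t0) i x0) + f (u x0 t0) := hpde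
    rw [hgrad] at hpde'
    have h7 := mul_pos hcpos hopx
    have h8 := mul_le_mul_of_nonneg_left hlap hd.le
    have h9 : c * φ x0 = u x0 t0 := heq.symm
    have h10 : μ * (c * φ x0) = μ * u x0 t0 := by rw [h9]
    rw [hL] at hge2
    nlinarith
  intro x hx
  have h1 := hle' x hx 1 (by simp)
  rw [sol.recur m x (by rw [hcl]; exact hx)]
  refine h1.trans ?_
  rw [mul_one]
  have h2 : C * Real.exp L * φ x ≤ G * M * Real.exp L * φ x := by
    have := hp x
    gcongr
  linarith

/-- Extinction on a ball in `ℝ³` of subcritical radius, with a divergence free drift. -/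
theorem ball_extinction
    (d R : ℝ) (hd : 0 < d) (hR : 0 < R)
    (Ω : Set (EuclideanSpace ℝ (Fin 3)))
    (hΩ : Ω = Metric.ball (0 : EuclideanSpace ℝ (Fin 3)) R)
    (a : EuclideanSpace ℝ (Fin 3) → EuclideanSpace ℝ (Fin 3))
    (ha : ContDiffOn ℝ 1 a (closure Ω))
    (hdiv : ∀ x ∈ Ω, (∑ i, pd (fun y => a y i) i x) = 0)
    (f g : ℝ → ℝ) (f'0 g'0 : ℝ) (hf : SatF f f'0) (hg : SatGext g g'0)
    (hpos : 0 < f'0 + Real.log g'0)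
    (hRlt : R < Real.pi * Real.sqrt (d / (f'0 + Real.log g'0)))
    (sol : ImpSol 3 Ω d a f g) :
    ∀ x ∈ Ω, Tendsto (fun m => sol.N m x) atTop (𝓝 0) := by
  subst hΩ
  have hcl : closure (Metric.ball (0:E3) R) = Metric.closedBall 0 R := closure_ball _ hR.ne'
  obtain ⟨-, -, -, -, h, -, -, -, hfN⟩ := hf
  obtain ⟨-, hg0, -, -, hg', hgN⟩ := hg
  set β := f'0 + Real.log g'0 with hβ
  have hβR : β < d * Real.pi ^ 2 / R ^ 2 := by
    have h1 : R ^ 2 < (Real.pi * Real.sqrt (d / β)) ^ 2 := by gcongr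
    rw [mul_pow, Real.sq_sqrt (by positivity)] at h1
    rw [lt_div_iff₀ (by positivity)]
    have h2 : β * R ^ 2 < β * (Real.pi ^ 2 * (d / β)) := by gcongr
    have h3 : β * (Real.pi ^ 2 * (d / β)) = d * Real.pi ^ 2 := by field_simp
    linarith
  obtain ⟨μ, hμ1, hμ2⟩ := exists_between hβR
  rw [lt_div_iff₀ (by positivity)] at hμ2
  obtain ⟨φ, hφ, hp, hop⟩ := exists_super d R μ hd hR (hpos.trans hμ1) hμ2 a
    (by rw [← hcl]; exact ha) hdiv
  have hφ2 : ContDiff ℝ 2 φ := contDiff_infty.1 hφ 2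
  have hN0c := sol.N_cont 0
  rw [hcl] at hN0c
  obtain ⟨M0, hM0⟩ := ((isCompact_closedBall (0:E3) R).bddAbove_image
    (hN0c.div hφ2.continuous.continuousOn (fun x _ => (hp x).ne')))
  set θ := g'0 * Real.exp (f'0 - μ) with hθ
  have hθ0 : 0 ≤ θ := by positivity
  have hθ1 : θ < 1 := by
    have : θ = Real.exp (β - μ) := by
      rw [hθ]
      conv_lhs => rw [← Real.exp_log hg', ← Real.exp_add]
      congr 1; rw [hβ]; ring
    rw [this, Real.exp_lt_one_iff]; linarith
  have hind : ∀ m, ∀ x ∈ Metric.closedBall (0:E3) R,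
      sol.N m x ≤ θ ^ m * max M0 0 * φ x := by
    intro m
    induction m with
    | zero =>
      intro x hx
      have h1 : sol.N 0 x / φ x ≤ M0 := hM0 ⟨x, hx, rfl⟩
      rw [div_le_iff₀ (hp x)] at h1
      have h2 := mul_le_mul_of_nonneg_right (le_max_left M0 0) (hp x).le
      simp only [pow_zero, one_mul]
      linarith
    | succ m ih =>
      intro x hx
      have := step d R μ f'0 g'0 hd hR hg' a f g (fun N hN => (hfN N hN).2)
        (fun N hN => by
          rcases hN.lt_or_eq with h | h
          · exact hgN N h
          · rw [← h, hg0]; simp) sol φ hφ2 hp hop m (θ ^ m * max M0 0) (by positivity) ih x hx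
      rw [pow_succ]
      refine this.trans (le_of_eq ?_)
      ring
  intro x hx
  have hx' := Metric.ball_subset_closedBall hx
  refine squeeze_zero (fun m => sol.N_nonneg m x (subset_closure hx)) (fun m => hind m x hx') ?_
  have := ((tendsto_pow_atTop_nhds_zero_of_lt_one hθ0 hθ1).mul_const (max M0 0)).mul_const (φ x)
  simpa using this
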